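/- arXiv:1402.5476 — 2 statements merged into one kernel-verified Lean document; each statement's English description precedes it below -/
import Mathlib

section
/- Let P : Ω → L(H) be a projection-valued smooth map with ∂̄P = P·∂̄P (i.e. an extended holomorphic curve). Then for every positive integer J, the mixed derivative satisfies ∂̄∂ᴶP = (∂ᴶP)(∂̄P) − (∂̄P)(∂ᴶP) − Σ_{k=1}^{J−1} C(J,k)·(∂^{J−k}P)(∂̄P)(∂ᵏP), where C(J,k) is the binomial coefficient. -/
open Complex ContinuousLinearMap

/-- Wirtinger derivative ∂ = ∂/∂λ. -/
noncomputable def pd {E : Type*} [NormedAddCommGroup E] [NormedSpace ℂ E]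
    (f : ℂ → E) : ℂ → E :=
  fun z => (2⁻¹ : ℂ) • (fderiv ℝ f z 1 - Complex.I • fderiv ℝ f z Complex.I)

/-- Wirtinger derivative ∂̄ = ∂/∂λ̄. -/
noncomputable def pdbar {E : Type*} [NormedAddCommGroup E] [NormedSpace ℂ E]
    (f : ℂ → E) : ℂ → E :=
  fun z => (2⁻¹ : ℂ) • (fderiv ℝ f z 1 + Complex.I • fderiv ℝ f z Complex.I)

section Wirtinger

variable {E : Type*} [NormedAddCommGroup E] [NormedSpace ℂ E] {f g : ℂ → E} {s : Set ℂ} {z : ℂ}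

theorem Filter.EventuallyEq.pd_eq (h : f =ᶠ[nhds z] g) : pd f z = pd g z := by
  simp only [pd, h.fderiv_eq]

theorem Filter.EventuallyEq.pdbar_eq (h : f =ᶠ[nhds z] g) : pdbar f z = pdbar g z := by
  simp only [pdbar, h.fderiv_eq]

theorem Set.EqOn.pd (h : Set.EqOn f g s) (hs : IsOpen s) : Set.EqOn (pd f) (pd g) s :=
  fun _ hz => (h.eventuallyEq_of_mem (hs.mem_nhds hz)).pd_eq

theorem Set.EqOn.pdbar (h : Set.EqOn f g s) (hs : IsOpen s) : Set.EqOn (pdbar f) (pdbar g) s :=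
  fun _ hz => (h.eventuallyEq_of_mem (hs.mem_nhds hz)).pdbar_eq

theorem pd_sub (hf : DifferentiableAt ℝ f z) (hg : DifferentiableAt ℝ g z) :
    pd (fun w => f w - g w) z = pd f z - pd g z := by
  simp only [pd, fderiv_fun_sub hf hg, sub_apply]
  module

theorem pd_nsmul (n : ℕ) (hf : DifferentiableAt ℝ f z) :
    pd (fun w => n • f w) z = n • pd f z := by
  have h : fderiv ℝ (fun w => n • f w) z = n • fderiv ℝ f z := (hf.hasFDerivAt.const_smul n).fderiv
  simp only [pd, h, smul_apply]
  module

theorem pd_const (c : E) : pd (fun _ => c) z = 0 := by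
  simp [pd]

theorem pdbar_const (c : E) : pdbar (fun _ => c) z = 0 := by
  simp [pdbar]

theorem pd_sum {ι : Type*} (t : Finset ι) {F : ι → ℂ → E}
    (hF : ∀ i ∈ t, DifferentiableAt ℝ (F i) z) :
    pd (fun w => ∑ i ∈ t, F i w) z = ∑ i ∈ t, pd (F i) z := by
  simp only [pd, fderiv_fun_sum hF, sum_apply, Finset.smul_sum, ← Finset.sum_sub_distrib]

theorem ContDiffOn.pd (hf : ContDiffOn ℝ (⊤ : ℕ∞) f s) (hs : IsOpen s) :
    ContDiffOn ℝ (⊤ : ℕ∞) (pd f) s := by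
  have h : ContDiffOn ℝ (⊤ : ℕ∞) (fderiv ℝ f) s := hf.fderiv_of_isOpen hs (by simp)
  exact ((h.clm_apply contDiffOn_const).sub
    ((h.clm_apply contDiffOn_const).const_smul Complex.I)).const_smul (2⁻¹ : ℂ)

theorem ContDiffOn.pdbar (hf : ContDiffOn ℝ (⊤ : ℕ∞) f s) (hs : IsOpen s) :
    ContDiffOn ℝ (⊤ : ℕ∞) (pdbar f) s := by
  have h : ContDiffOn ℝ (⊤ : ℕ∞) (fderiv ℝ f) s := hf.fderiv_of_isOpen hs (by simp)
  exact ((h.clm_apply contDiffOn_const).add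
    ((h.clm_apply contDiffOn_const).const_smul Complex.I)).const_smul (2⁻¹ : ℂ)

theorem ContDiffOn.iterate_pd (hf : ContDiffOn ℝ (⊤ : ℕ∞) f s) (hs : IsOpen s) (n : ℕ) :
    ContDiffOn ℝ (⊤ : ℕ∞) (_root_.pd^[n] f) s := by
  induction n with
  | zero => exact hf
  | succ n ih => rw [Function.iterate_succ_apply']; exact ih.pd hs

theorem ContDiffOn.differentiableAt_of_isOpen (hf : ContDiffOn ℝ (⊤ : ℕ∞) f s) (hs : IsOpen s)
    (hz : z ∈ s) : DifferentiableAt ℝ f z :=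
  (hf.contDiffAt (hs.mem_nhds hz)).differentiableAt (by simp)

theorem pdbar_pd_comm (hs : IsOpen s) (hf : ContDiffOn ℝ (⊤ : ℕ∞) f s) (hz : z ∈ s) :
    pdbar (pd f) z = pd (pdbar f) z := by
  replace hf : ContDiffAt ℝ 2 f z :=
    (hf.contDiffAt (hs.mem_nhds hz)).of_le (WithTop.coe_le_coe.2 le_top)
  have hd : DifferentiableAt ℝ (fderiv ℝ f) z :=
    (hf.fderiv_right (m := 1) (by norm_num)).differentiableAt (by simp)
  have hv (v : ℂ) : HasFDerivAt (fun w => fderiv ℝ f w v)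
      ((fderiv ℝ (fderiv ℝ f) z).flip v) z := by
    simpa using hd.hasFDerivAt.clm_apply (hasFDerivAt_const v z)
  have hsymm := hf.isSymmSndFDerivAt (by simp) 1 Complex.I
  have h1 : fderiv ℝ (pd f) z = _ :=
    (((hv 1).sub ((hv Complex.I).const_smul Complex.I)).const_smul (2⁻¹ : ℂ)).fderiv
  have h2 : fderiv ℝ (pdbar f) z = _ :=
    (((hv 1).add ((hv Complex.I).const_smul Complex.I)).const_smul (2⁻¹ : ℂ)).fderiv
  rw [pdbar, h1, pd, h2]
  simp only [smul_apply, sub_apply, add_apply, flip_apply, hsymm]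
  module

end Wirtinger

section WirtingerMul

variable {A : Type*} [NormedRing A] [NormedAlgebra ℂ A] {f g : ℂ → A} {z : ℂ}

theorem pd_mul (hf : DifferentiableAt ℝ f z) (hg : DifferentiableAt ℝ g z) :
    pd (fun w => f w * g w) z = pd f z * g z + f z * pd g z := by
  simp only [pd, fderiv_fun_mul' hf hg, add_apply, smul_apply, op_smul_eq_mul, smul_eq_mul,
    smul_mul_assoc, mul_smul_comm, sub_mul, mul_sub]
  module

theorem pdbar_mul (hf : DifferentiableAt ℝ f z) (hg : DifferentiableAt ℝ g z) :
    pdbar (fun w => f w * g w) z = pdbar f z * g z + f z * pdbar g z := by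
  simp only [pdbar, fderiv_fun_mul' hf hg, add_apply, smul_apply, op_smul_eq_mul, smul_eq_mul,
    smul_mul_assoc, mul_smul_comm, add_mul, mul_add]
  module

end WirtingerMul

theorem pd_eq_star_pdbar {E : Type*} [NormedAddCommGroup E] [NormedSpace ℂ E]
    [StarAddMonoid E] [NormedStarGroup E] [StarModule ℂ E] {f : ℂ → E} {z : ℂ}
    (hf : DifferentiableAt ℝ f z)
    (hstar : ∀ᶠ w in nhds z, star (f w) = f w) : pd f z = star (pdbar f z) := by
  have : StarModule ℝ E := ⟨fun r x => by
    simp⟩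
  have h : fderiv ℝ f z = _ :=
    (hf.hasFDerivAt.star.congr_of_eventuallyEq (hstar.mono fun w hw => hw.symm)).fderiv
  have hv (v : ℂ) : star (fderiv ℝ f z v) = fderiv ℝ f z v := by
    conv_rhs => rw [h]
    simp
  simp [pd, pdbar, hv, sub_eq_add_neg]

section Projection

variable {A : Type*} [NormedRing A] [NormedAlgebra ℂ A] {P : ℂ → A} {s : Set ℂ} {z : ℂ}

theorem pdbar_mul_self_eq_zero (hs : IsOpen s) (hP : ContDiffOn ℝ (⊤ : ℕ∞) P s)
    (hidem : ∀ z ∈ s, P z * P z = P z) (hhol : ∀ z ∈ s, pdbar P z = P z * pdbar P z)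
    (hz : z ∈ s) : pdbar P z * P z = 0 := by
  have hd := hP.differentiableAt_of_isOpen hs hz
  have h : pdbar (fun w => P w * P w) z = pdbar P z :=
    Set.EqOn.pdbar (fun w hw => hidem w hw) hs hz
  rw [pdbar_mul hd hd, ← hhol z hz] at h
  simpa using h

theorem mul_iterate_pd_eq_zero (hs : IsOpen s) (hP : ContDiffOn ℝ (⊤ : ℕ∞) P s)
    (h0 : ∀ z ∈ s, P z * pd P z = 0) (h1 : ∀ z ∈ s, pd P z * P z = pd P z) (n : ℕ) :
    ∀ z ∈ s, P z * (pd^[n + 1] P) z = 0 := by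
  induction n with
  | zero => exact h0
  | succ n ih =>
    intro z hz
    have h : pd (fun w => P w * (pd^[n + 1] P) w) z = pd (fun _ => (0 : A)) z :=
      Set.EqOn.pd (fun w hw => ih w hw) hs hz
    rw [pd_mul (hP.differentiableAt_of_isOpen hs hz)
      ((hP.iterate_pd hs _).differentiableAt_of_isOpen hs hz), pd_const, ← h1 z hz, mul_assoc,
      ih z hz, mul_zero, zero_add] at h
    rwa [Function.iterate_succ_apply']

theorem iterate_pd_mul_self (hs : IsOpen s) (hP : ContDiffOn ℝ (⊤ : ℕ∞) P s)
    (h0 : ∀ z ∈ s, P z * pd P z = 0) (h1 : ∀ z ∈ s, pd P z * P z = pd P z) (n : ℕ) :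
    ∀ z ∈ s, (pd^[n + 1] P) z * P z = (pd^[n + 1] P) z := by
  induction n with
  | zero => exact h1
  | succ n ih =>
    intro z hz
    have h : pd (fun w => (pd^[n + 1] P) w * P w) z = pd (pd^[n + 1] P) z :=
      Set.EqOn.pd (fun w hw => ih w hw) hs hz
    rw [pd_mul ((hP.iterate_pd hs _).differentiableAt_of_isOpen hs hz)
      (hP.differentiableAt_of_isOpen hs hz), ← ih z hz, mul_assoc _ (P z), h0 z hz, mul_zero,
      add_zero] at h
    rwa [Function.iterate_succ_apply']

theorem pd_pdbar_of_projection (hs : IsOpen s) (hP : ContDiffOn ℝ (⊤ : ℕ∞) P s)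
    (hhol : ∀ z ∈ s, pdbar P z = P z * pdbar P z) (h0 : ∀ z ∈ s, P z * pd P z = 0)
    (hz : z ∈ s) :
    pd (pdbar P) z = pd P z * pdbar P z - pdbar P z * pd P z := by
  have hd := hP.differentiableAt_of_isOpen hs hz
  have h : pd (pdbar P) z = pd (fun w => P w * pdbar P w) z :=
    Set.EqOn.pd (fun w hw => hhol w hw) hs hz
  have h' : pdbar (fun w => P w * pd P w) z = pdbar (fun _ => (0 : A)) z :=
    Set.EqOn.pdbar (fun w hw => h0 w hw) hs hz
  rw [pd_mul hd ((hP.pdbar hs).differentiableAt_of_isOpen hs hz)] at h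
  rw [pdbar_mul hd ((hP.pd hs).differentiableAt_of_isOpen hs hz), pdbar_const,
    pdbar_pd_comm hs hP hz] at h'
  rw [h, eq_neg_of_add_eq_zero_right h', sub_eq_add_neg]

/-- Leibniz rule for the binomial sums `∑ C(n, k) (∂ⁱf) g (∂ᵏf)`, `i + k = n`. -/
theorem pd_sum_antidiagonal_choose {f g : ℂ → A} (hs : IsOpen s)
    (hf : ContDiffOn ℝ (⊤ : ℕ∞) f s) (hg : ContDiffOn ℝ (⊤ : ℕ∞) g s) (n : ℕ) (hz : z ∈ s) :
    pd (fun w => ∑ p ∈ Finset.HasAntidiagonal.antidiagonal n,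
        n.choose p.2 • ((pd^[p.1] f) w * g w * (pd^[p.2] f) w)) z =
      (∑ p ∈ Finset.HasAntidiagonal.antidiagonal (n + 1),
        (n + 1).choose p.2 • ((pd^[p.1] f) z * g z * (pd^[p.2] f) z)) +
      ∑ p ∈ Finset.HasAntidiagonal.antidiagonal n,
        n.choose p.2 • ((pd^[p.1] f) z * pd g z * (pd^[p.2] f) z) := by
  have hdf (k : ℕ) := (hf.iterate_pd hs k).differentiableAt_of_isOpen hs hz
  have hdg := hg.differentiableAt_of_isOpen hs hz
  rw [pd_sum _ fun p _ => (((hdf p.1).fun_mul hdg).fun_mul (hdf p.2)).fun_const_smul (n.choose p.2),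
    ← Finset.Nat.sum_antidiagonal_swap (n := n + 1)]
  simp only [Prod.fst_swap, Prod.snd_swap]
  rw [Finset.sum_antidiagonal_choose_succ_nsmul
    (fun i j => (pd^[j] f) z * g z * (pd^[i] f) z)]
  rw [← Finset.Nat.sum_antidiagonal_swap (n := n), ← Finset.Nat.sum_antidiagonal_swap (n := n)
    (f := fun p => n.choose p.2 • ((pd^[p.1] f) z * pd g z * (pd^[p.2] f) z)),
    ← Finset.sum_add_distrib, ← Finset.sum_add_distrib]
  refine Finset.sum_congr rfl fun p hp => ?_
  rw [Finset.HasAntidiagonal.mem_antidiagonal] at hp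
  have hc : n.choose p.2 = n.choose p.1 := (Nat.choose_symm_of_eq_add hp.symm).symm
  simp only [Prod.fst_swap, Prod.snd_swap]
  rw [pd_nsmul _ (((hdf p.2).fun_mul hdg).fun_mul (hdf p.1)), pd_mul ((hdf p.2).fun_mul hdg) (hdf p.1),
    pd_mul (hdf p.2) hdg, hc]
  simp only [Function.iterate_succ_apply', add_mul, smul_add]
  abel

theorem pdbar_iterate_pd_of_projection (hs : IsOpen s) (hP : ContDiffOn ℝ (⊤ : ℕ∞) P s)
    (hidem : ∀ z ∈ s, P z * P z = P z) (hhol : ∀ z ∈ s, pdbar P z = P z * pdbar P z)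
    (h0 : ∀ z ∈ s, P z * pd P z = 0) (h1 : ∀ z ∈ s, pd P z * P z = pd P z) (n : ℕ) :
    ∀ z ∈ s, pdbar (pd^[n + 1] P) z = (pd^[n + 1] P) z * pdbar P z -
      ∑ p ∈ Finset.HasAntidiagonal.antidiagonal (n + 1),
        (n + 1).choose p.2 • ((pd^[p.1] P) z * pdbar P z * (pd^[p.2] P) z) := by
  have hQP : ∀ z ∈ s, pdbar P z * P z = 0 :=
    fun z hz => pdbar_mul_self_eq_zero hs hP hidem hhol hz
  have hΔ : ∀ z ∈ s, pd (pdbar P) z = pd P z * pdbar P z - pdbar P z * pd P z :=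
    fun z hz => pd_pdbar_of_projection hs hP hhol h0 hz
  induction n with
  | zero =>
    intro z hz
    have hc := pdbar_pd_comm hs hP hz
    simp [hc, hΔ z hz, mul_assoc, hQP z hz, Finset.Nat.antidiagonal_succ]
    rw [← mul_assoc, ← hhol z hz]
  | succ n ih =>
    intro z hz
    have hd (k : ℕ) := (hP.iterate_pd hs k).differentiableAt_of_isOpen hs hz
    have hdQ := (hP.pdbar hs).differentiableAt_of_isOpen hs hz
    rw [Function.iterate_succ_apply' pd (n + 1), pdbar_pd_comm hs (hP.iterate_pd hs _) hz,
      Set.EqOn.pd (fun w hw => ih w hw) hs hz, pd_sub ((hd _).fun_mul hdQ)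
      (DifferentiableAt.fun_sum fun (p : ℕ × ℕ) _ =>
        (((hd p.1).fun_mul hdQ).fun_mul (hd p.2)).fun_const_smul ((n + 1).choose p.2)),
      pd_mul (hd _) hdQ, pd_sum_antidiagonal_choose hs hP (hP.pdbar hs) _ hz]
    have hPD (k : ℕ) := mul_iterate_pd_eq_zero hs hP h0 h1 k z hz
    have hDP (k : ℕ) := iterate_pd_mul_self hs hP h0 h1 k z hz
    have hD1D (k : ℕ) : pd P z * (pd^[k + 1] P) z = 0 := by
      rw [← h1 z hz, mul_assoc, hPD, mul_zero]
    have hDD1 (k : ℕ) : (pd^[k + 1] P) z * pd P z = 0 := by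
      rw [← hDP, mul_assoc, h0 z hz, mul_zero]
    have hmain : ∑ p ∈ Finset.HasAntidiagonal.antidiagonal (n + 1),
        (n + 1).choose p.2 • ((pd^[p.1] P) z * pd (pdbar P) z * (pd^[p.2] P) z) =
        (pd^[n + 1] P) z * pd (pdbar P) z := by
      rw [Finset.sum_eq_single (n + 1, 0)]
      · simp only [Nat.choose_zero_right, one_smul, Function.iterate_zero, id, hΔ z hz]
        simp only [mul_sub, ← mul_assoc, hDD1, zero_mul, zero_sub]
        rw [neg_mul, mul_assoc _ (pd P z), h1 z hz]
      · rintro ⟨i, j⟩ hij hne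
        rw [Finset.HasAntidiagonal.mem_antidiagonal] at hij
        obtain _ | j := j
        · exact absurd (by simpa using hij) hne
        have hr : pd (pdbar P) z * (pd^[j + 1] P) z =
            pd P z * pdbar P z * (pd^[j + 1] P) z := by
          rw [hΔ z hz, sub_mul, mul_assoc (pdbar P z), hD1D, mul_zero, sub_zero]
        have hl : (pd^[i] P) z * pd P z = 0 := by
          obtain _ | i := i
          · exact h0 z hz
          · exact hDD1 i
        simp only
        rw [mul_assoc, hr, ← mul_assoc, ← mul_assoc, hl, zero_mul, zero_mul, smul_zero]
      · simp
    rw [hmain]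
    abel

end Projection

theorem stmt1
    {H : Type*} [NormedAddCommGroup H] [InnerProductSpace ℂ H] [CompleteSpace H]
    (Ω : Set ℂ) (hΩ : IsOpen Ω) (hconn : IsConnected Ω)
    (P : ℂ → H →L[ℂ] H)
    (hsmooth : ContDiffOn ℝ (⊤ : ℕ∞) P Ω)
    (hproj : ∀ z ∈ Ω, P z * P z = P z ∧ ContinuousLinearMap.adjoint (P z) = P z)
    (hhol : ∀ z ∈ Ω, pdbar P z = P z * pdbar P z) :
    ∀ J : ℕ, 1 ≤ J → ∀ z ∈ Ω,
      pdbar (pd^[J] P) z =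
        (pd^[J] P) z * pdbar P z - pdbar P z * (pd^[J] P) z -
          ∑ k ∈ Finset.Ico 1 J,
            (J.choose k : ℂ) • ((pd^[J - k] P) z * pdbar P z * (pd^[k] P) z) := by
  intro J hJ z hz
  obtain ⟨n, rfl⟩ : ∃ n, J = n + 1 := ⟨J - 1, by omega⟩
  have hidem : ∀ z ∈ Ω, P z * P z = P z := fun z hz => (hproj z hz).1
  have hQP := fun z (hz : z ∈ Ω) => pdbar_mul_self_eq_zero hΩ hsmooth hidem hhol hz
  have hstar : ∀ z ∈ Ω, star (P z) = P z := fun z hz => (hproj z hz).2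
  have hpd : ∀ z ∈ Ω, pd P z = star (pdbar P z) := fun z hz =>
    pd_eq_star_pdbar (hsmooth.differentiableAt_of_isOpen hΩ hz)
      (Filter.eventually_of_mem (hΩ.mem_nhds hz) hstar)
  have h0 : ∀ z ∈ Ω, P z * pd P z = 0 := fun z hz => by
    simpa [hstar z hz, hpd z hz] using congrArg star (hQP z hz)
  have h1 : ∀ z ∈ Ω, pd P z * P z = pd P z := fun z hz => by
    simpa [hstar z hz, hpd z hz] using congrArg star (hhol z hz).symm
  rw [pdbar_iterate_pd_of_projection hΩ hsmooth hidem hhol h0 h1 n z hz, sub_sub,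
    ← Finset.Nat.sum_antidiagonal_swap,
    Finset.Nat.sum_antidiagonal_eq_sum_range_succ_mk, Finset.sum_range_succ,
    Finset.range_eq_Ico, Finset.sum_eq_sum_Ico_succ_bot (by omega)]
  simp [mul_assoc, hQP z hz, Nat.cast_smul_eq_nsmul]
  rw [← mul_assoc, ← hhol z hz, add_comm]
end

section
/- In the setting P = F h^{-1} F* with F holomorphic and h = F*F invertible, with curvature K_P = −∂̄(h^{-1}∂h), one has (∂̄²P)(∂²P) − 2·((∂̄P)(∂P))² = F·(−K_{P,z z̄})·h^{-1}·F*, where K_{P,z z̄} = ∂̄(∂K_P + [h^{-1}∂h, K_P]). -/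
open Complex ContinuousLinearMap

/-- `f` is real differentiable at `z`, with Wirtinger derivatives `∂f = a` and `∂̄f = b`. -/
structure HasWirtingerAt {E : Type*} [NormedAddCommGroup E] [NormedSpace ℂ E]
    (f : ℂ → E) (a b : E) (z : ℂ) : Prop where
  differentiableAt : DifferentiableAt ℝ f z
  pd_eq : pd f z = a
  pdbar_eq : pdbar f z = b

namespace HasWirtingerAt

section Normed

variable {E : Type*} [NormedAddCommGroup E] [NormedSpace ℂ E]
  {f g : ℂ → E} {a b a' b' : E} {z : ℂ}

theorem of_hasFDerivAt {L : ℂ →L[ℝ] E} (hf : HasFDerivAt f L z) :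
    HasWirtingerAt f ((2⁻¹ : ℂ) • (L 1 - I • L I)) ((2⁻¹ : ℂ) • (L 1 + I • L I)) z :=
  ⟨hf.differentiableAt, by simp [pd, hf.fderiv], by simp [pdbar, hf.fderiv]⟩

theorem of_hasDerivAt (hf : HasDerivAt f a z) : HasWirtingerAt f a 0 z := by
  have hW := of_hasFDerivAt (hf.hasFDerivAt.restrictScalars ℝ)
  have hI : I • I • a = -a := by rw [smul_smul, I_mul_I, neg_one_smul]
  convert hW using 1
  · simp only [coe_restrictScalars', toSpanSingleton_apply, hI, one_smul]
    module
  · simp [hI]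

theorem congr (hf : HasWirtingerAt f a b z) (hfg : g =ᶠ[nhds z] f) :
    HasWirtingerAt g a b z :=
  ⟨hf.differentiableAt.congr_of_eventuallyEq hfg,
    by rw [← hf.pd_eq]; simp only [pd, hfg.fderiv_eq],
    by rw [← hf.pdbar_eq]; simp only [pdbar, hfg.fderiv_eq]⟩

theorem congr_on {s : Set ℂ} (hf : HasWirtingerAt f a b z) (hs : IsOpen s) (hz : z ∈ s)
    (hfg : ∀ w ∈ s, g w = f w) : HasWirtingerAt g a b z :=
  hf.congr (Filter.eventuallyEq_of_mem (hs.mem_nhds hz) hfg)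

theorem neg (hf : HasWirtingerAt f a b z) :
    HasWirtingerAt (fun w => -f w) (-a) (-b) z := by
  obtain ⟨hd, rfl, rfl⟩ := hf
  convert of_hasFDerivAt hd.hasFDerivAt.fun_neg using 1 <;> simp only [pd, pdbar, neg_apply] <;> module

theorem add (hf : HasWirtingerAt f a b z) (hg : HasWirtingerAt g a' b' z) :
    HasWirtingerAt (fun w => f w + g w) (a + a') (b + b') z := by
  obtain ⟨hd, rfl, rfl⟩ := hf
  obtain ⟨hd', rfl, rfl⟩ := hg
  convert of_hasFDerivAt (hd.hasFDerivAt.fun_add hd'.hasFDerivAt) using 1 <;>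
    simp only [pd, pdbar, add_apply] <;> module

theorem sub (hf : HasWirtingerAt f a b z) (hg : HasWirtingerAt g a' b' z) :
    HasWirtingerAt (fun w => f w - g w) (a - a') (b - b') z := by
  simpa only [sub_eq_add_neg] using hf.add hg.neg

end Normed

section Operator

variable {X Y Z : Type*} [NormedAddCommGroup X] [NormedSpace ℂ X]
  [NormedAddCommGroup Y] [NormedSpace ℂ Y] [NormedAddCommGroup Z] [NormedSpace ℂ Z] {z : ℂ}

theorem comp {f : ℂ → Y →L[ℂ] Z} {g : ℂ → X →L[ℂ] Y} {a b : Y →L[ℂ] Z} {a' b' : X →L[ℂ] Y}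
    (hf : HasWirtingerAt f a b z) (hg : HasWirtingerAt g a' b' z) :
    HasWirtingerAt (fun w => f w ∘L g w)
      (a ∘L g z + f z ∘L a') (b ∘L g z + f z ∘L b') z := by
  obtain ⟨hd, rfl, rfl⟩ := hf
  obtain ⟨hd', rfl, rfl⟩ := hg
  have hB := ((compL ℂ X Y Z).bilinearRestrictScalars ℝ).hasFDerivAt_of_bilinear
    hd.hasFDerivAt hd'.hasFDerivAt
  convert of_hasFDerivAt hB using 1 <;> ext x <;>
    simp [pd, pdbar] <;> module

theorem inverse [CompleteSpace X] {h hi : ℂ → X →L[ℂ] X} {a b : X →L[ℂ] X} {s : Set ℂ}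
    (hs : IsOpen s) (hz : z ∈ s) (hh : HasWirtingerAt h a b z) (hu : IsUnit (h z))
    (hhi : ∀ w ∈ s, hi w = Ring.inverse (h w)) :
    HasWirtingerAt hi (-(hi z ∘L a ∘L hi z)) (-(hi z ∘L b ∘L hi z)) z := by
  obtain ⟨hd, rfl, rfl⟩ := hh
  obtain ⟨u, hu⟩ := hu
  have hinv := ((hasFDerivAt_ringInverse (𝕜 := ℂ) u).restrictScalars ℝ)
  rw [hu] at hinv
  have huz : hi z = ↑u⁻¹ := by rw [hhi z hz, ← hu, Ring.inverse_unit]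
  refine HasWirtingerAt.congr_on ?_ hs hz hhi
  rw [huz]
  convert of_hasFDerivAt (hinv.comp z hd.hasFDerivAt) using 1 <;> ext x <;>
    simp [pd, pdbar] <;> module

end Operator

theorem adjoint {H K : Type*} [NormedAddCommGroup H] [InnerProductSpace ℂ H] [CompleteSpace H]
    [NormedAddCommGroup K] [InnerProductSpace ℂ K] [CompleteSpace K]
    {f : ℂ → K →L[ℂ] H} {a b : K →L[ℂ] H} {z : ℂ} (hf : HasWirtingerAt f a b z) :
    HasWirtingerAt (fun w => ContinuousLinearMap.adjoint (f w))
      (ContinuousLinearMap.adjoint b) (ContinuousLinearMap.adjoint a) z := by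
  obtain ⟨hd, rfl, rfl⟩ := hf
  let A : (K →L[ℂ] H) →L[ℝ] (H →L[ℂ] K) :=
    LinearMap.mkContinuous
      { toFun := fun T => ContinuousLinearMap.adjoint T
        map_add' := fun S T => map_add _ S T
        map_smul' := fun r T => by
          simpa using
            (ContinuousLinearMap.adjoint (𝕜 := ℂ) (E := K) (F := H)).map_smulₛₗ (r : ℂ) T } 1
      (fun T => by simp)
  have hA : HasFDerivAt (fun w => ContinuousLinearMap.adjoint (f w)) (A ∘L fderiv ℝ f z) z :=
    (A.hasFDerivAt (x := f z)).comp z hd.hasFDerivAt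
  have h2 : starRingEnd ℂ 2 = 2 := Complex.conj_ofNat 2
  convert of_hasFDerivAt hA using 1 <;>
    simp [pd, pdbar, A, map_smulₛₗ, sub_eq_add_neg, h2]

end HasWirtingerAt

theorem stmt9
    {H K : Type*} [NormedAddCommGroup H] [InnerProductSpace ℂ H] [CompleteSpace H]
    [NormedAddCommGroup K] [InnerProductSpace ℂ K] [CompleteSpace K]
    (Ω : Set ℂ) (hΩ : IsOpen Ω)
    (F : ℂ → K →L[ℂ] H)
    (hF : DifferentiableOn ℂ F Ω)
    (h : ℂ → K →L[ℂ] K)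
    (hdef : ∀ z ∈ Ω, h z = ContinuousLinearMap.adjoint (F z) ∘L F z)
    (hinv : ∀ z ∈ Ω, IsUnit (h z))
    (hi : ℂ → K →L[ℂ] K) (hhi : ∀ z ∈ Ω, hi z = Ring.inverse (h z))
    (P : ℂ → H →L[ℂ] H)
    (hP : ∀ z ∈ Ω, P z = F z ∘L hi z ∘L ContinuousLinearMap.adjoint (F z))
    (KP : ℂ → K →L[ℂ] K)
    (hKP : ∀ z ∈ Ω, KP z = -(pdbar (fun w => hi w * pd h w) z))
    (θ : ℂ → K →L[ℂ] K) (hθ : ∀ z ∈ Ω, θ z = hi z * pd h z)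
    (Kzzbar : ℂ → K →L[ℂ] K)
    (hKzzbar : ∀ z ∈ Ω,
      Kzzbar z = pdbar (fun w => pd KP w + (θ w * KP w - KP w * θ w)) z)
    : ∀ z ∈ Ω,
      (pdbar^[2] P) z * (pd^[2] P) z - 2 • (pdbar P z * pd P z) ^ 2 =
        F z ∘L ((-(Kzzbar z)) * hi z) ∘L ContinuousLinearMap.adjoint (F z) := by
  have hFW : ∀ z ∈ Ω, HasWirtingerAt F (deriv F z) 0 z := fun z hz =>
    .of_hasDerivAt (hF.differentiableAt (hΩ.mem_nhds hz)).hasDerivAt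
  have hF₁W : ∀ z ∈ Ω, HasWirtingerAt (deriv F) (deriv (deriv F) z) 0 z := fun z hz =>
    .of_hasDerivAt ((hF.deriv hΩ).differentiableAt (hΩ.mem_nhds hz)).hasDerivAt
  have hF₂W : ∀ z ∈ Ω, HasWirtingerAt (deriv (deriv F)) (deriv (deriv (deriv F)) z) 0 z :=
    fun z hz => .of_hasDerivAt
      (((hF.deriv hΩ).deriv hΩ).differentiableAt (hΩ.mem_nhds hz)).hasDerivAt
  obtain ⟨F₁, hF₁⟩ : ∃ F₁, F₁ = deriv F := ⟨_, rfl⟩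
  obtain ⟨F₂, hF₂⟩ : ∃ F₂, F₂ = deriv F₁ := ⟨_, rfl⟩
  rw [← hF₁] at hFW hF₁W hF₂W
  rw [← hF₂] at hF₁W hF₂W
  obtain ⟨G, hG⟩ : ∃ G : ℂ → H →L[ℂ] K, ∀ w, adjoint (F w) = G w := ⟨_, fun _ => rfl⟩
  obtain ⟨G₁, hG₁⟩ : ∃ G : ℂ → H →L[ℂ] K, ∀ w, adjoint (F₁ w) = G w := ⟨_, fun _ => rfl⟩
  obtain ⟨G₂, hG₂⟩ : ∃ G : ℂ → H →L[ℂ] K, ∀ w, adjoint (F₂ w) = G w := ⟨_, fun _ => rfl⟩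
  have hGW : ∀ z ∈ Ω, HasWirtingerAt G 0 (G₁ z) z := fun z hz => by
    simpa only [hG, hG₁, map_zero] using (hFW z hz).adjoint
  have hG₁W : ∀ z ∈ Ω, HasWirtingerAt G₁ 0 (G₂ z) z := fun z hz => by
    simpa only [hG₂, hG₁, map_zero] using (hF₁W z hz).adjoint
  simp only [hG] at hdef hP ⊢
  have hhW : ∀ z ∈ Ω, HasWirtingerAt h (G z ∘L F₁ z) (G₁ z ∘L F z) z := fun z hz => by
    simpa using ((hGW z hz).comp (hFW z hz)).congr_on hΩ hz hdef
  have hiW : ∀ z ∈ Ω, HasWirtingerAt hi (-(hi z ∘L (G z ∘L F₁ z) ∘L hi z))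
      (-(hi z ∘L (G₁ z ∘L F z) ∘L hi z)) z := fun z hz =>
    .inverse hΩ hz (hhW z hz) (hinv z hz) hhi
  have hright : ∀ z ∈ Ω, ∀ x, G z (F z (hi z x)) = x := fun z hz x => by
    have := DFunLike.congr_fun (Ring.mul_inverse_cancel _ (hinv z hz)) x
    rw [← hhi z hz, hdef z hz] at this
    simpa using this
  have hleft : ∀ z ∈ Ω, ∀ x, hi z (G z (F z x)) = x := fun z hz x => by
    have := DFunLike.congr_fun (Ring.inverse_mul_cancel _ (hinv z hz)) x
    rw [← hhi z hz, hdef z hz] at this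
    simpa using this
  have hPW : ∀ z ∈ Ω, HasWirtingerAt P
      ((F₁ z - F z ∘L hi z ∘L G z ∘L F₁ z) ∘L hi z ∘L G z)
      (F z ∘L hi z ∘L (G₁ z - G₁ z ∘L F z ∘L hi z ∘L G z)) z := fun z hz => by
    convert ((hFW z hz).comp ((hiW z hz).comp (hGW z hz))).congr_on hΩ hz hP using 1 <;> ext x <;>
      simp <;> abel
  have hθW : ∀ z ∈ Ω, HasWirtingerAt (fun w => hi w ∘L G w ∘L F₁ w)
      (hi z ∘L G z ∘L F₂ z - hi z ∘L G z ∘L F₁ z ∘L hi z ∘L G z ∘L F₁ z)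
      (hi z ∘L (G₁ z - G₁ z ∘L F z ∘L hi z ∘L G z) ∘L F₁ z) z := fun z hz => by
    convert (hiW z hz).comp ((hGW z hz).comp (hF₁W z hz)) using 1 <;> ext x <;>
      simp <;> abel
  have hKP' : ∀ z ∈ Ω,
      KP z = -(hi z ∘L (G₁ z - G₁ z ∘L F z ∘L hi z ∘L G z) ∘L F₁ z) := fun z hz => by
    rw [hKP z hz]
    refine congrArg _ ((hθW z hz).congr_on hΩ hz fun w hw => ?_).pdbar_eq
    rw [(hhW w hw).pd_eq]
    rfl
  have hPdd : ∀ z ∈ Ω, pd^[2] P z =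
      (F₂ z - F z ∘L hi z ∘L G z ∘L F₂ z - 2 • (F₁ z ∘L hi z ∘L G z ∘L F₁ z)
        + 2 • (F z ∘L hi z ∘L G z ∘L F₁ z ∘L hi z ∘L G z ∘L F₁ z)) ∘L hi z ∘L G z := fun z hz => by
    have hW := (((hF₁W z hz).sub ((hFW z hz).comp (hθW z hz))).comp
      ((hiW z hz).comp (hGW z hz))).congr_on hΩ hz fun w hw => (hPW w hw).pd_eq
    refine hW.pd_eq.trans ?_
    ext x
    simp [two_smul]
    abel
  have hPbb : ∀ z ∈ Ω, pdbar^[2] P z =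
      F z ∘L hi z ∘L (G₂ z - G₂ z ∘L F z ∘L hi z ∘L G z - 2 • (G₁ z ∘L F z ∘L hi z ∘L G₁ z)
        + 2 • (G₁ z ∘L F z ∘L hi z ∘L G₁ z ∘L F z ∘L hi z ∘L G z)) := fun z hz => by
    have hW := ((hFW z hz).comp ((hiW z hz).comp ((hG₁W z hz).sub ((hG₁W z hz).comp
      ((hFW z hz).comp ((hiW z hz).comp (hGW z hz))))))).congr_on hΩ hz
        fun w hw => (hPW w hw).pdbar_eq
    refine hW.pdbar_eq.trans ?_
    ext x
    simp [two_smul]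
    abel
  have hKz : ∀ z ∈ Ω, pd KP z + (θ z * KP z - KP z * θ z) =
      -(hi z ∘L (G₁ z - G₁ z ∘L F z ∘L hi z ∘L G z) ∘L
        (F₂ z - (F₁ z ∘L hi z ∘L G z ∘L F₁ z + F₁ z ∘L hi z ∘L G z ∘L F₁ z))) := fun z hz => by
    have hW := ((hiW z hz).comp (((hG₁W z hz).sub ((hG₁W z hz).comp ((hFW z hz).comp
      ((hiW z hz).comp (hGW z hz))))).comp (hF₁W z hz))).neg.congr_on hΩ hz hKP'
    rw [hW.pd_eq, hθ z hz, (hhW z hz).pd_eq, hKP' z hz]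
    ext x
    simp
    abel
  intro z hz
  have hKzW := ((hiW z hz).comp (((hG₁W z hz).sub ((hG₁W z hz).comp ((hFW z hz).comp
      ((hiW z hz).comp (hGW z hz))))).comp ((hF₂W z hz).sub
        (((hF₁W z hz).comp (hθW z hz)).add ((hF₁W z hz).comp (hθW z hz)))))).neg.congr_on hΩ hz hKz
  rw [hKzzbar z hz, hKzW.pdbar_eq, hPdd z hz, hPbb z hz, (hPW z hz).pd_eq, (hPW z hz).pdbar_eq]
  ext x
  simp [two_smul, pow_two, hright z hz]
  abel
end
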